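/- Let p be a prime with p ≡ ±1 (mod 8), let K = PSL(2,p) regarded as a normal subgroup of G = PGL(2,p), and let T be a Klein four-subgroup of K. Then for every element g ∈ G \ K, the subgroup g⁻¹Tg is not conjugate to T in K. In particular, every element of G outside K interchanges the two K-conjugacy classes of Klein four-subgroups of K. -/

import Mathlib

/-- `PGL(n, p)`: the projective general linear group of degree `n` over `ZMod p`. -/
abbrev PGL (n p : ℕ) : Type :=
  GL (Fin n) (ZMod p) ⧸ Subgroup.center (GL (Fin n) (ZMod p))

/-- The copy of `PSL(2,p)` inside `PGL(2,p)`: the image of `SL(2,p)` in the quotient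
of `GL(2,p)` by its center. -/
def pslInPGL (p : ℕ) : Subgroup (PGL 2 p) :=
  ((QuotientGroup.mk' (Subgroup.center (GL (Fin 2) (ZMod p)))).comp
    Matrix.SpecialLinearGroup.toGL).range

open Matrix

/-- Two invertible matrices have the same class in `PGL(n, p)` exactly when they are proportional. -/
lemma PGL.mk_eq_mk_iff {n p : ℕ} {M N : GL (Fin n) (ZMod p)} :
    (QuotientGroup.mk M : PGL n p) = QuotientGroup.mk N ↔
      ∃ c : (ZMod p)ˣ, (N : Matrix (Fin n) (Fin n) (ZMod p)) = (c : ZMod p) • M.val := by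
  rw [QuotientGroup.eq, GeneralLinearGroup.center_eq_range_scalar, MonoidHom.mem_range]
  refine exists_congr fun c => ?_
  rw [eq_comm, inv_mul_eq_iff_eq_mul, Units.ext_iff, Units.val_mul, GeneralLinearGroup.coe_scalar,
    scalar_apply, ← smul_one_eq_diagonal, mul_smul_comm, mul_one]

lemma mk_mem_pslInPGL_iff {p : ℕ} [Fact p.Prime] (M : GL (Fin 2) (ZMod p)) :
    (QuotientGroup.mk M : PGL 2 p) ∈ pslInPGL p ↔ IsSquare M.val.det := by
  constructor
  · rintro ⟨S, hS⟩
    obtain ⟨c, hc⟩ := PGL.mk_eq_mk_iff.mp (hS : (QuotientGroup.mk S.toGL : PGL 2 p) = _)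
    refine ⟨c, ?_⟩
    rw [hc, det_smul, SpecialLinearGroup.coe_GL_coe_matrix, S.det_coe]
    simp [sq]
  · rintro ⟨c, hc⟩
    have hM : M.val.det ≠ 0 := (M.isUnit.map detMonoidHom).ne_zero
    have hc0 : c ≠ 0 := by
      rintro rfl
      simp [hc] at hM
    refine ⟨⟨c⁻¹ • M.val, ?_⟩, ?_⟩
    · rw [det_smul, hc, Fintype.card_fin]
      field_simp
    · exact PGL.mk_eq_mk_iff.mpr ⟨Units.mk0 c hc0, (smul_inv_smul₀ hc0 M.val).symm⟩

/-- A non-scalar determinant one matrix whose square is scalar squares to `-1`. -/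
lemma Matrix.mul_self_eq_neg_one {F : Type*} [Field F] {A : Matrix (Fin 2) (Fin 2) F}
    (hdet : A.det = 1) (hA : ∀ c : F, A ≠ c • 1) {c : F} (hsq : A * A = c • 1) :
    A * A = -1 := by
  have hCH : A * A = A.trace • A - 1 := by
    rw [det_fin_two] at hdet
    ext i j
    fin_cases i <;> fin_cases j <;> simp [mul_apply, trace_fin_two] <;> grind
  have htr : A.trace = 0 := by
    by_contra h
    refine hA (A.trace⁻¹ * (c + 1)) ?_
    rw [mul_smul, add_smul, one_smul, ← hsq, hCH, sub_add_cancel, smul_smul, inv_mul_cancel₀ h,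
      one_smul]
  rw [hCH, htr, zero_smul, zero_sub]

/-- A `2 × 2` matrix commuting with two non-commuting matrices is scalar. -/
lemma Matrix.eq_smul_one_of_commute {F : Type*} [Field F] {A B M : Matrix (Fin 2) (Fin 2) F}
    (hAB : A * B ≠ B * A) (hA : M * A = A * M) (hB : M * B = B * M) : ∃ c : F, M = c • 1 := by
  refine ⟨M 0 0, ?_⟩
  by_contra hM
  apply hAB
  have a1 := congr_fun₂ hA 0 0
  have a2 := congr_fun₂ hA 0 1
  have a3 := congr_fun₂ hA 1 0
  have b1 := congr_fun₂ hB 0 0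
  have b2 := congr_fun₂ hB 0 1
  have b3 := congr_fun₂ hB 1 0
  simp only [mul_apply, Fin.sum_univ_two] at a1 a2 a3 b1 b2 b3
  by_cases h1 : M 0 1 = 0
  · by_cases h2 : M 1 0 = 0
    · have h3 : M 1 1 - M 0 0 ≠ 0 := by
        intro h3
        apply hM
        ext i j
        fin_cases i <;> fin_cases j <;> simp [h1, h2, sub_eq_zero.mp h3]
      ext i j
      apply mul_left_cancel₀ h3
      fin_cases i <;> fin_cases j <;> simp [mul_apply] <;> grind
    · ext i j
      apply mul_left_cancel₀ h2
      fin_cases i <;> fin_cases j <;> simp [mul_apply] <;> grind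
  · ext i j
    apply mul_left_cancel₀ h1
    fin_cases i <;> fin_cases j <;> simp [mul_apply] <;> grind

/-- In `PSL(2,p)`, a pair of commuting involutions lifts to a pair of quaternion generators. -/
lemma exists_quaternion_lift {p : ℕ} [Fact p.Prime] {x y : PGL 2 p} (hx : x ∈ pslInPGL p)
    (hy : y ∈ pslInPGL p) (hx1 : x ≠ 1) (hy1 : y ≠ 1) (hxy : x ≠ y) (hxx : x * x = 1)
    (hyy : y * y = 1) (hxyxy : x * y * (x * y) = 1) :
    ∃ A B : GL (Fin 2) (ZMod p), (QuotientGroup.mk A : PGL 2 p) = x ∧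
      (QuotientGroup.mk B : PGL 2 p) = y ∧ A.val.det = 1 ∧ B.val.det = 1 ∧
      A.val * A.val = -1 ∧ B.val * B.val = -1 ∧ B.val * A.val = -(A.val * B.val) := by
  have key : ∀ S : SpecialLinearGroup (Fin 2) (ZMod p),
      (QuotientGroup.mk S.toGL : PGL 2 p) ≠ 1 →
      (QuotientGroup.mk S.toGL : PGL 2 p) * QuotientGroup.mk S.toGL = 1 →
      S.toGL.val * S.toGL.val = -1 := by
    intro S h1 h2
    obtain ⟨c, hc⟩ := PGL.mk_eq_mk_iff.mp
      (h2.symm : (QuotientGroup.mk 1 : PGL 2 p) = QuotientGroup.mk (S.toGL * S.toGL))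
    refine mul_self_eq_neg_one (c := c) S.det_coe (fun d hd => h1 ?_) (by simpa using hc)
    have hd0 : d ≠ 0 := by
      rintro rfl
      have := S.det_coe
      rw [SpecialLinearGroup.coe_GL_coe_matrix] at hd
      simp [hd] at this
    exact (PGL.mk_eq_mk_iff (M := 1).mpr ⟨Units.mk0 d hd0, by simpa using hd⟩).symm
  obtain ⟨S, rfl⟩ := hx
  obtain ⟨R, rfl⟩ := hy
  have hA := key S hx1 hxx
  have hB := key R hy1 hyy
  have hAB := key (S * R) (fun h => hxy ?_) (by rw [map_mul]; exact hxyxy)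
  · refine ⟨S.toGL, R.toGL, rfl, rfl, S.det_coe, R.det_coe, hA, hB, ?_⟩
    rw [map_mul, Units.val_mul] at hAB
    generalize S.toGL.val = A at *
    generalize R.toGL.val = B at *
    calc B * A = (A * A) * (B * A) * (B * B) := by simp [hA, hB]
      _ = A * ((A * B) * (A * B)) * B := by simp only [mul_assoc]
      _ = -(A * B) := by simp [hAB]
  · rw [map_mul] at h
    exact mul_right_cancel (Eq.trans h hyy.symm)

/-- An element centralizing a Klein four-subgroup of `PSL(2,p)` lies in `PSL(2,p)`. -/
lemma mem_pslInPGL_of_commute {p : ℕ} [Fact p.Prime] (hp2 : p ≠ 2) {x y : PGL 2 p}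
    (hx : x ∈ pslInPGL p)
    (hy : y ∈ pslInPGL p) (hx1 : x ≠ 1) (hy1 : y ≠ 1) (hxy : x ≠ y) (hxx : x * x = 1)
    (hyy : y * y = 1) (hxyxy : x * y * (x * y) = 1) {m : PGL 2 p} (hmx : m * x = x * m)
    (hmy : m * y = y * m) : m ∈ pslInPGL p := by
  obtain ⟨A, B, rfl, rfl, dA, dB, hA, hB, hBA⟩ :=
    exists_quaternion_lift hx hy hx1 hy1 hxy hxx hyy hxyxy
  obtain ⟨M, rfl⟩ := QuotientGroup.mk_surjective m
  have h2 : (2 : ZMod p) ≠ 0 := Ring.two_ne_zero (by rwa [ZMod.ringChar_zmod_n])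
  have sign : ∀ C : GL (Fin 2) (ZMod p), (QuotientGroup.mk M : PGL 2 p) * QuotientGroup.mk C =
      QuotientGroup.mk C * QuotientGroup.mk M →
      C.val * M.val = M.val * C.val ∨ C.val * M.val = -(M.val * C.val) := by
    intro C h
    obtain ⟨c, hc⟩ := PGL.mk_eq_mk_iff.mp
      (h : (QuotientGroup.mk (M * C) : PGL 2 p) = QuotientGroup.mk (C * M))
    rw [Units.val_mul, Units.val_mul] at hc
    have hd := congr_arg det hc
    have hM : M.val.det ≠ 0 := (M.isUnit.map detMonoidHom).ne_zero
    have hC : C.val.det ≠ 0 := (C.isUnit.map detMonoidHom).ne_zero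
    rw [det_smul, det_mul, det_mul, Fintype.card_fin, mul_comm C.val.det,
      right_eq_mul₀ (mul_ne_zero hM hC), sq_eq_one_iff] at hd
    rcases hd with hd | hd <;> simp [hc, hd]
  have hne : A.val * B.val ≠ B.val * A.val := by
    intro h
    rw [hBA, eq_neg_iff_add_eq_zero, ← two_smul (ZMod p), smul_eq_zero] at h
    have hd := congr_arg det (h.resolve_left h2)
    simp [dA, dB] at hd
  rw [mk_mem_pslInPGL_iff]
  have scal : ∀ N : Matrix (Fin 2) (Fin 2) (ZMod p), N.det = 1 →
      M.val * N * A.val = A.val * (M.val * N) → M.val * N * B.val = B.val * (M.val * N) →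
      IsSquare M.val.det := by
    intro N hN h1 h2
    obtain ⟨c, hc⟩ := eq_smul_one_of_commute hne h1 h2
    refine ⟨c, ?_⟩
    have hd := congr_arg det hc
    simpa [hN, sq] using hd
  have hA' (N : Matrix (Fin 2) (Fin 2) (ZMod p)) : A.val * (A.val * N) = -N := by
    rw [← mul_assoc, hA, neg_mul, one_mul]
  rcases sign A hmx with h | h <;> rcases sign B hmy with h' | h'
  · exact scal 1 (by simp) (by simp [h]) (by simp [h'])
  · refine scal A.val dA ?_ ?_ <;> simp [← mul_assoc, h, h', mul_assoc _ B.val A.val, hBA]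
  · refine scal B.val dB ?_ ?_ <;> simp [← mul_assoc, h, h', mul_assoc _ B.val A.val, hBA]
  · refine scal (A.val * B.val) (by simp [dA, dB]) ?_ ?_ <;> simp only [← mul_assoc, h, h'] <;>
      simp [mul_assoc, hBA, hB, hA']

/-- If `2` is a square, `PSL(2,p)` induces transpositions on the involutions of its Klein
four-subgroups. -/
lemma exists_mem_pslInPGL_swap {p : ℕ} [Fact p.Prime] (hp2 : p ≠ 2) (hsq : IsSquare (2 : ZMod p))
    {x y : PGL 2 p} (hx : x ∈ pslInPGL p)
    (hy : y ∈ pslInPGL p) (hx1 : x ≠ 1) (hy1 : y ≠ 1) (hxy : x ≠ y) (hxx : x * x = 1)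
    (hyy : y * y = 1) (hxyxy : x * y * (x * y) = 1) :
    ∃ u ∈ pslInPGL p, u * x = x * u ∧ u * y = x * y * u := by
  obtain ⟨A, B, rfl, rfl, dA, dB, hA, hB, hBA⟩ :=
    exists_quaternion_lift hx hy hx1 hy1 hxy hxx hyy hxyxy
  have h2 : (2 : ZMod p) ≠ 0 := Ring.two_ne_zero (by rwa [ZMod.ringChar_zmod_n])
  have hdet : (1 + A.val).det = 2 := by
    have h := congr_arg det (show B.val * (1 + A.val) = (1 - A.val) * B.val by
      rw [mul_add, hBA, sub_mul, mul_one, one_mul, sub_eq_add_neg])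
    rw [det_mul, det_mul, dB, one_mul, mul_one] at h
    apply mul_left_cancel₀ h2
    simp only [det_fin_two, Matrix.add_apply, Matrix.sub_apply, one_apply_eq, ne_eq, zero_ne_one,
      one_ne_zero, not_false_eq_true, one_apply_ne] at h dA ⊢
    linear_combination h + 2 * dA
  let U : GL (Fin 2) (ZMod p) := GeneralLinearGroup.mkOfDetNeZero (1 + A.val) (by rwa [hdet])
  have hU : U.val = 1 + A.val := rfl
  refine ⟨QuotientGroup.mk U, (mk_mem_pslInPGL_iff U).mpr (by rwa [hU, hdet]), ?_, ?_⟩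
  · refine congr_arg QuotientGroup.mk (a₁ := U * A) (a₂ := A * U) (Units.ext ?_)
    simp [hU, mul_add, add_mul]
  · refine congr_arg QuotientGroup.mk (a₁ := U * B) (a₂ := A * B * U) (Units.ext ?_)
    simp only [Units.val_mul, hU, mul_add, add_mul, mul_assoc, hBA]
    simp [← mul_assoc, hA, add_comm]

/-- A Klein four-subgroup `T` whose involutions are permuted arbitrarily by elements of `K` has its
normalizer inside `K`, provided that its centralizer is. -/
lemma Subgroup.mem_of_map_conj_eq_of_swap {G : Type*} [Group G] {K T : Subgroup G}
    (hTcard : Nat.card T = 4) (hTelem : ∀ x ∈ T, x * x = 1)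
    (hcent : ∀ x ∈ T, ∀ y ∈ T, x ≠ 1 → y ≠ 1 → x ≠ y → ∀ m, m * x = x * m → m * y = y * m → m ∈ K)
    (hswap : ∀ x ∈ T, ∀ y ∈ T, x ≠ 1 → y ≠ 1 → x ≠ y →
      ∃ u ∈ K, u * x = x * u ∧ u * y = x * y * u)
    {m : G} (hm : ∀ x ∈ T, m * x * m⁻¹ ∈ T) : m ∈ K := by
  have : ∃ a ∈ T, ∃ b ∈ T, a ≠ 1 ∧ b ≠ 1 ∧ a ≠ b ∧ ∀ t ∈ T, t = 1 ∨ t = a ∨ t = b ∨ t = a * b := by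
    have hfin : Finite T := Nat.finite_of_card_ne_zero (by simp [hTcard])
    have : IsKleinFour T := by
      have hnt : Nontrivial T := Finite.one_lt_card_iff_nontrivial.mp (by simp [hTcard])
      exact ⟨hTcard, (Monoid.exponent_eq_prime_iff Nat.prime_two).mpr fun t ht =>
        orderOf_eq_prime (by rw [sq]; exact Subtype.ext (hTelem t t.2)) ht⟩
    have := Fintype.ofFinite T
    have hcard : Finset.card (Finset.univ : Finset T) = 4 := by
      rw [Finset.card_univ, ← Nat.card_eq_fintype_card, hTcard]
    classical
    obtain ⟨a, ha⟩ := Finset.exists_mem_notMem_of_card_lt_card (s := {(1 : T)}) (t := Finset.univ)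
      (by rw [hcard]; simp)
    obtain ⟨b, hb⟩ := Finset.exists_mem_notMem_of_card_lt_card (s := {1, a}) (t := Finset.univ)
      (Finset.card_le_two.trans_lt (by rw [hcard]; simp))
    simp only [Finset.mem_univ, Finset.mem_insert, Finset.mem_singleton, true_and, not_or] at ha hb
    refine ⟨a, a.2, b, b.2, by simpa using ha, by simpa using hb.1,
      fun h => hb.2 (Subtype.ext h.symm), fun t ht => ?_⟩
    by_contra! h
    refine h.2.2.2 (congr_arg Subtype.val (IsKleinFour.eq_mul_of_ne_all (z := ⟨t, ht⟩) ha hb.1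
      (Ne.symm hb.2) ?_ ?_ ?_)) <;> simp [Subtype.ext_iff, h]
  obtain ⟨a, ha, b, hb, ha1, hb1, hab, hT⟩ := this
  have haa := hTelem a ha
  have hbb := hTelem b hb
  have hcomm : b * a = a * b := by
    have := hTelem _ (T.mul_mem ha hb)
    calc b * a = (a * a) * (b * a) * (b * b) := by simp [haa, hbb]
      _ = a * ((a * b) * (a * b)) * b := by simp only [mul_assoc]
      _ = a * b := by simp [this]
  have hc1 : a * b ≠ 1 := fun h => hab (mul_right_cancel (h.trans hbb.symm))
  have hca : a * b ≠ a := by simpa using hb1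
  have hab' : a * (a * b) = b := by rw [← mul_assoc, haa, one_mul]
  have hba' : a * b * b = a := by rw [mul_assoc, hbb, mul_one]
  have haba : a * b * a = b := by rw [← hcomm, mul_assoc, haa, mul_one]
  have hcT := T.mul_mem ha hb
  obtain ⟨u, huK, hua, hub⟩ := hswap a ha b hb ha1 hb1 hab
  obtain ⟨v, hvK, hvb, hva⟩ := hswap b hb a ha hb1 ha1 hab.symm
  obtain ⟨w, hwK, hwc, hwa⟩ := hswap (a * b) hcT a ha hc1 ha1 hca
  rw [hcomm] at hva
  rw [haba] at hwa
  have hwb : w * b = a * w := by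
    calc w * b = w * (a * b) * a := by rw [mul_assoc, haba]
      _ = a * w := by rw [hwc, mul_assoc, hwa, ← mul_assoc, hba']
  have huc : u * (a * b) = b * u := by rw [← mul_assoc, hua, mul_assoc, hub, ← mul_assoc, hab']
  have hvc : v * (a * b) = a * v := by rw [← mul_assoc, hva, mul_assoc, hvb, ← mul_assoc, hba']
  have step : ∀ k ∈ K, ∀ x y x' y' : G, k * x = x' * k → k * y = y' * k →
      (∀ m, m * a = x' * m → m * b = y' * m → m ∈ K) →
      ∀ m, m * a = x * m → m * b = y * m → m ∈ K := by
    intro k hk x y x' y' hx hy h m hma hmb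
    refine (K.mul_mem_cancel_left hk).mp (h (k * m) ?_ ?_)
    · rw [mul_assoc, hma, ← mul_assoc, hx, mul_assoc]
    · rw [mul_assoc, hmb, ← mul_assoc, hy, mul_assoc]
  have Pab := hcent a ha b hb ha1 hb1 hab
  have Pac := step u huK _ _ _ _ hua huc Pab
  have Pcb := step v hvK _ _ _ _ hvc hvb Pab
  have Pba := step w hwK _ _ _ _ hwb hwa Pab
  have Pbc := step u huK _ _ _ _ hub huc Pcb
  have Pca := step v hvK _ _ _ _ hvc hva Pac
  have hma : m * a = m * a * m⁻¹ * m := by simp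
  have hmb : m * b = m * b * m⁻¹ * m := by simp
  have hx1 : m * a * m⁻¹ ≠ 1 := by simpa using ha1
  have hy1 : m * b * m⁻¹ ≠ 1 := by simpa using hb1
  have hxy : m * a * m⁻¹ ≠ m * b * m⁻¹ := by simpa using hab
  have hx := hT _ (hm a ha)
  have hy := hT _ (hm b hb)
  generalize m * a * m⁻¹ = x at *
  generalize m * b * m⁻¹ = y at *
  rcases hx with rfl | rfl | rfl | rfl <;> rcases hy with rfl | rfl | rfl | rfl <;>
    first
    | contradiction
    | exact Pab m hma hmb
    | exact Pac m hma hmb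
    | exact Pcb m hma hmb
    | exact Pba m hma hmb
    | exact Pbc m hma hmb
    | exact Pca m hma hmb

/-- For a prime `p ≡ ±1 (mod 8)`, a Klein four-subgroup `T` of `K = PSL(2,p)` and any
`g ∈ PGL(2,p) \ K`, the subgroup `g⁻¹Tg` is not conjugate to `T` in `K`. -/
theorem statement10 (p : ℕ) (hp : p.Prime) (hpm : p % 8 = 1 ∨ p % 8 = 7)
    (T : Subgroup (PGL 2 p)) (hTK : T ≤ pslInPGL p)
    (hTcard : Nat.card T = 4) (hTelem : ∀ x ∈ T, x * x = 1) :
    ∀ g : PGL 2 p, g ∉ pslInPGL p →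
      ¬∃ k ∈ pslInPGL p,
        (T.map (MulAut.conj g⁻¹).toMonoidHom).map (MulAut.conj k⁻¹).toMonoidHom = T := by
  have : Fact p.Prime := ⟨hp⟩
  have hp2 : p ≠ 2 := by lia
  have hsq := (ZMod.exists_sq_eq_two_iff hp2).mpr hpm
  rintro g hg ⟨k, hk, hT⟩
  suffices h : k⁻¹ * g⁻¹ ∈ pslInPGL p by
    apply hg
    simpa using mul_mem hk h
  refine Subgroup.mem_of_map_conj_eq_of_swap hTcard hTelem ?_ ?_ fun x hx => ?_
  · intro x hx y hy hx1 hy1 hxy m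
    exact mem_pslInPGL_of_commute hp2 (hTK hx) (hTK hy) hx1 hy1 hxy (hTelem x hx) (hTelem y hy)
      (hTelem _ (T.mul_mem hx hy))
  · intro x hx y hy hx1 hy1 hxy
    exact exists_mem_pslInPGL_swap hp2 hsq (hTK hx) (hTK hy) hx1 hy1 hxy (hTelem x hx)
      (hTelem y hy) (hTelem _ (T.mul_mem hx hy))
  · have := Subgroup.mem_map_of_mem (MulAut.conj k⁻¹).toMonoidHom
      (Subgroup.mem_map_of_mem (MulAut.conj g⁻¹).toMonoidHom hx)
    rw [hT] at this
    simpa [mul_assoc] using this
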